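/- Let K be a field, σ a finite type of indeterminates, and fix an admissible monomial order ≼ on σ →₀ ℕ. Let G be a finite set of polynomials in MvPolynomial σ K. Then G is a Gröbner basis if and only if for every nonzero p in the ideal generated by G there exists a nonzero g ∈ G such that lp(g) divides lp(p), i.e., lp(g) ≤ lp(p) pointwise as elements of σ →₀ ℕ. -/

import Mathlib

open MvPolynomial Relation

/-- An admissible monomial order on `σ →₀ ℕ`: a linear order such that `0` is the
smallest element and which is compatible with addition. -/
structure AdmissibleOrder (σ : Type*) where
  le : (σ →₀ ℕ) → (σ →₀ ℕ) → Prop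
  total : ∀ s t, le s t ∨ le t s
  refl : ∀ t, le t t
  trans : ∀ s t u, le s t → le t u → le s u
  antisymm : ∀ s t, le s t → le t s → s = t
  zero_le : ∀ t, le 0 t
  add_right : ∀ s t u, le s t → le (s + u) (t + u)

namespace AdmissibleOrder

variable {σ : Type*} {K : Type*} [Field K]

/-- The strict part of an admissible order. -/
def lt (m : AdmissibleOrder σ) (s t : σ →₀ ℕ) : Prop := m.le s t ∧ s ≠ t

-- The leading monomial of a polynomial: the `m.le`-largest element of its support
-- (`0` for the zero polynomial).
open Classical in
noncomputable def lm (m : AdmissibleOrder σ) (p : MvPolynomial σ K) : σ →₀ ℕ :=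
  if h : ∃ v, v ∈ p.support ∧ ∀ u ∈ p.support, m.le u v then h.choose else 0

/-- The leading coefficient of a polynomial. -/
noncomputable def lc (m : AdmissibleOrder σ) (p : MvPolynomial σ K) : K :=
  coeff (m.lm p) p

/-- One-step polynomial reduction modulo a set `F`. -/
def Red (m : AdmissibleOrder σ) (F : Set (MvPolynomial σ K))
    (p q : MvPolynomial σ K) : Prop :=
  ∃ f ∈ F, f ≠ 0 ∧ ∃ t : σ →₀ ℕ,
    coeff (t + m.lm f) p ≠ 0 ∧
    q = p - (coeff (t + m.lm f) p / m.lc f) • (monomial t (1 : K)) * f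

/-- A set `G` is a Gröbner basis iff the reduction relation modulo `G` is confluent. -/
def IsGroebner (m : AdmissibleOrder σ) (G : Set (MvPolynomial σ K)) : Prop :=
  ∀ a b c : MvPolynomial σ K, ReflTransGen (m.Red G) a b → ReflTransGen (m.Red G) a c →
    ∃ d, ReflTransGen (m.Red G) b d ∧ ReflTransGen (m.Red G) c d

-- The S-polynomial of two polynomials.
open Classical in
noncomputable def spoly (m : AdmissibleOrder σ) (p q : MvPolynomial σ K) :
    MvPolynomial σ K :=
  if p = 0 ∨ q = 0 then 0 else
    (monomial (m.lm p ⊔ m.lm q - m.lm p) (1 / m.lc p)) * p -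
    (monomial (m.lm p ⊔ m.lm q - m.lm q) (1 / m.lc q)) * q

end AdmissibleOrder

namespace AdmissibleOrder

section Order

variable {σ : Type*} (m : AdmissibleOrder σ)

theorem le_of_le {s t : σ →₀ ℕ} (h : s ≤ t) : m.le s t := by
  obtain ⟨u, rfl⟩ := exists_add_of_le h
  simpa [add_comm] using m.add_right 0 u s (m.zero_le u)

theorem wellFounded_lt [Finite σ] : WellFounded m.lt := by
  have : IsStrictOrder (σ →₀ ℕ) m.lt :=
    { irrefl := fun _ h => h.2 rfl
      trans := fun a b c hab hbc => ⟨m.trans _ _ _ hab.1 hbc.1, fun h => by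
        subst h
        exact hab.2 (m.antisymm _ _ hab.1 hbc.1)⟩ }
  rw [RelEmbedding.wellFounded_iff_isEmpty]
  refine ⟨fun f => ?_⟩
  obtain ⟨i, j, hij, hle⟩ := wellQuasiOrdered_le (α := σ →₀ ℕ) f
  have hlt : m.lt (f j) (f i) := f.map_rel_iff.2 hij
  exact hlt.2 (m.antisymm _ _ hlt.1 (m.le_of_le hle))

theorem exists_greatest {s : Finset (σ →₀ ℕ)} (hs : s.Nonempty) :
    ∃ v, v ∈ s ∧ ∀ u ∈ s, m.le u v := by
  induction hs using Finset.Nonempty.cons_induction with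
  | singleton a => exact ⟨a, by simp, by simpa using m.refl a⟩
  | cons a s ha hs ih =>
    obtain ⟨v, hv, hmax⟩ := ih
    rcases m.total a v with h | h
    · exact ⟨v, by simp [hv], by simpa using ⟨h, hmax⟩⟩
    · exact ⟨a, by simp, by simpa using ⟨m.refl a, fun u hu => m.trans _ _ _ (hmax u hu) h⟩⟩

end Order

section Reduction

variable {σ : Type*} {K : Type*} [Field K] (m : AdmissibleOrder σ)

theorem lm_spec {p : MvPolynomial σ K} (hp : p ≠ 0) :
    m.lm p ∈ p.support ∧ ∀ u ∈ p.support, m.le u (m.lm p) := by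
  have h := m.exists_greatest (support_nonempty.2 hp)
  rw [lm, dif_pos h]
  exact h.choose_spec

theorem lc_ne_zero {p : MvPolynomial σ K} (hp : p ≠ 0) : m.lc p ≠ 0 :=
  mem_support_iff.1 (m.lm_spec hp).1

theorem coeff_add_lm_monomial_mul (f : MvPolynomial σ K) (t : σ →₀ ℕ) (c : K) :
    coeff (t + m.lm f) (monomial t c * f) = c * m.lc f :=
  coeff_monomial_mul _ _ _ _

theorem le_of_coeff_monomial_mul_ne_zero {f : MvPolynomial σ K} (hf : f ≠ 0)
    {t u : σ →₀ ℕ} {c : K} (h : coeff u (monomial t c * f) ≠ 0) :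
    m.le u (t + m.lm f) := by
  rw [coeff_monomial_mul'] at h
  split_ifs at h with htu
  · have := m.add_right _ _ t ((m.lm_spec hf).2 _ (mem_support_iff.2 (right_ne_zero_of_mul h)))
    rwa [tsub_add_cancel_of_le htu, add_comm] at this
  · exact absurd rfl h

/-- Eliminate the monomial `t + m.lm f` from `p` by subtracting a multiple of `f`. -/
noncomputable def reduceAt (f : MvPolynomial σ K) (t : σ →₀ ℕ) (p : MvPolynomial σ K) :
    MvPolynomial σ K :=
  p - monomial t (coeff (t + m.lm f) p / m.lc f) * f

theorem red_iff {G : Set (MvPolynomial σ K)} {p q : MvPolynomial σ K} :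
    m.Red G p q ↔ ∃ f ∈ G, f ≠ 0 ∧ ∃ t : σ →₀ ℕ,
      coeff (t + m.lm f) p ≠ 0 ∧ q = m.reduceAt f t p := by
  simp only [Red, reduceAt, smul_monomial, smul_eq_mul, mul_one]

theorem reduceAt_sub (f : MvPolynomial σ K) (t : σ →₀ ℕ) (p q : MvPolynomial σ K) :
    m.reduceAt f t (p - q) = m.reduceAt f t p - m.reduceAt f t q := by
  simp only [reduceAt, coeff_sub, sub_div, map_sub]
  ring

theorem reduceAt_monomial_mul {f : MvPolynomial σ K} (hf : f ≠ 0) (t : σ →₀ ℕ) (c : K) :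
    m.reduceAt f t (monomial t c * f) = 0 := by
  rw [reduceAt, coeff_add_lm_monomial_mul, mul_div_cancel_right₀ _ (m.lc_ne_zero hf), sub_self]

theorem coeff_reduceAt {f : MvPolynomial σ K} (hf : f ≠ 0) (t : σ →₀ ℕ)
    (p : MvPolynomial σ K) : coeff (t + m.lm f) (m.reduceAt f t p) = 0 := by
  rw [reduceAt, coeff_sub, coeff_add_lm_monomial_mul, div_mul_cancel₀ _ (m.lc_ne_zero hf),
    sub_self]

theorem le_of_mem_support_reduceAt {f p : MvPolynomial σ K} (hf : f ≠ 0) {s t : σ →₀ ℕ}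
    (hp : ∀ u ∈ p.support, m.le u s) (ht : m.le (t + m.lm f) s) :
    ∀ u ∈ (m.reduceAt f t p).support, m.le u s := by
  intro u hu
  by_cases hpu : coeff u p = 0
  · rw [mem_support_iff, reduceAt, coeff_sub, hpu, zero_sub, neg_ne_zero] at hu
    exact m.trans _ _ _ (m.le_of_coeff_monomial_mul_ne_zero hf hu) ht
  · exact hp u (mem_support_iff.2 hpu)

theorem reduceAt_mem {I : Ideal (MvPolynomial σ K)} {f p : MvPolynomial σ K} (hf : f ∈ I)
    (hp : p ∈ I) (t : σ →₀ ℕ) : m.reduceAt f t p ∈ I :=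
  I.sub_mem hp (I.mul_mem_left _ hf)

variable {G : Set (MvPolynomial σ K)}

theorem reflTransGen_reduceAt {f : MvPolynomial σ K} (hfG : f ∈ G) (hf : f ≠ 0) (t : σ →₀ ℕ)
    (p : MvPolynomial σ K) : ReflTransGen (m.Red G) p (m.reduceAt f t p) := by
  by_cases h : coeff (t + m.lm f) p = 0
  · simp only [reduceAt, h, zero_div, monomial_zero, zero_mul, sub_zero]
    exact .refl
  · exact .single (m.red_iff.2 ⟨f, hfG, hf, t, h, rfl⟩)

theorem sub_mem_span_of_reflTransGen {p q : MvPolynomial σ K}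
    (h : ReflTransGen (m.Red G) p q) : p - q ∈ Ideal.span G := by
  induction h with
  | refl => simp
  | @tail b c _ hbc ih =>
    obtain ⟨f, hfG, -, t, -, rfl⟩ := m.red_iff.1 hbc
    have := add_mem ih (Ideal.mul_mem_left _
      (monomial t (coeff (t + m.lm f) b / m.lc f)) (Ideal.subset_span hfG))
    rwa [reduceAt, sub_sub_eq_add_sub, add_sub_right_comm]

theorem join_of_sub_eq_monomial_mul {f : MvPolynomial σ K} (hfG : f ∈ G) (hf : f ≠ 0)
    {t : σ →₀ ℕ} {c : K} {p q : MvPolynomial σ K} (h : p - q = monomial t c * f) :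
    Join (ReflTransGen (m.Red G)) p q := by
  refine ⟨m.reduceAt f t p, m.reflTransGen_reduceAt hfG hf t p, ?_⟩
  have := m.reduceAt_sub f t p q
  rw [h, m.reduceAt_monomial_mul hf, eq_comm, sub_eq_zero] at this
  rw [this]
  exact m.reflTransGen_reduceAt hfG hf t q

theorem IsGroebner.join_trans {m : AdmissibleOrder σ} (hG : m.IsGroebner G)
    {p q r : MvPolynomial σ K} (hpq : Join (ReflTransGen (m.Red G)) p q)
    (hqr : Join (ReflTransGen (m.Red G)) q r) : Join (ReflTransGen (m.Red G)) p r := by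
  obtain ⟨u, hpu, hqu⟩ := hpq
  obtain ⟨v, hqv, hrv⟩ := hqr
  obtain ⟨w, huw, hvw⟩ := hG q u v hqu hqv
  exact ⟨w, hpu.trans huw, hrv.trans hvw⟩

theorem IsGroebner.join_add_mul {m : AdmissibleOrder σ} (hG : m.IsGroebner G)
    {f : MvPolynomial σ K} (hfG : f ∈ G) (a q : MvPolynomial σ K) :
    Join (ReflTransGen (m.Red G)) (a * f + q) q := by
  rcases eq_or_ne f 0 with rfl | hf
  · simpa using refl_of (Join (ReflTransGen (m.Red G))) q
  induction a using MvPolynomial.monomial_add_induction_on generalizing q with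
  | C c => exact m.join_of_sub_eq_monomial_mul (t := 0) (c := c) hfG hf (add_sub_cancel_right _ _)
  | monomial_add t c a _ _ ih =>
    rw [add_mul, add_assoc]
    exact hG.join_trans (m.join_of_sub_eq_monomial_mul hfG hf (add_sub_cancel_right _ _)) (ih q)

theorem IsGroebner.join_add {m : AdmissibleOrder σ} (hG : m.IsGroebner G)
    {p : MvPolynomial σ K} (hp : p ∈ Ideal.span G) (q : MvPolynomial σ K) :
    Join (ReflTransGen (m.Red G)) (p + q) q := by
  induction hp using Submodule.closure_induction generalizing q with
  | zero => simpa using refl_of (Join (ReflTransGen (m.Red G))) q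
  | add x y _ _ ihx ihy =>
    rw [add_assoc]
    exact hG.join_trans (ihx _) (ihy q)
  | smul_mem a f hf => exact hG.join_add_mul hf a q

theorem eq_zero_of_reflTransGen_zero {p : MvPolynomial σ K}
    (h : ReflTransGen (m.Red G) 0 p) : p = 0 := by
  induction h with
  | refl => rfl
  | tail _ hbc ih =>
    subst ih
    obtain ⟨f, -, -, t, ht, -⟩ := m.red_iff.1 hbc
    simp at ht

theorem IsGroebner.reflTransGen_zero {m : AdmissibleOrder σ} (hG : m.IsGroebner G)
    {p : MvPolynomial σ K} (hp : p ∈ Ideal.span G) : ReflTransGen (m.Red G) p 0 := by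
  obtain ⟨d, hpd, hd⟩ := hG.join_add hp 0
  rwa [m.eq_zero_of_reflTransGen_zero hd, add_zero] at hpd

/-- Reduction preserves a leading monomial that no leading monomial of `G` divides. -/
theorem greatest_support_of_reflTransGen {p q : MvPolynomial σ K} {s : σ →₀ ℕ}
    (hs : ∀ g ∈ G, g ≠ 0 → ¬ m.lm g ≤ s) (h : ReflTransGen (m.Red G) p q)
    (hp : s ∈ p.support ∧ ∀ u ∈ p.support, m.le u s) :
    s ∈ q.support ∧ ∀ u ∈ q.support, m.le u s := by
  induction h with
  | refl => exact hp
  | @tail b c _ hbc ih =>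
    obtain ⟨f, hfG, hf, t, ht, rfl⟩ := m.red_iff.1 hbc
    have hle : m.le (t + m.lm f) s := ih.2 _ (mem_support_iff.2 ht)
    refine ⟨?_, m.le_of_mem_support_reduceAt hf ih.2 hle⟩
    have hzero : coeff s (monomial t (coeff (t + m.lm f) b / m.lc f) * f) = 0 := by
      by_contra hne
      have := m.antisymm _ _ hle (m.le_of_coeff_monomial_mul_ne_zero hf hne)
      exact hs f hfG hf (this ▸ self_le_add_left _ _)
    rw [mem_support_iff, reduceAt, coeff_sub, hzero, sub_zero]
    exact mem_support_iff.1 ih.1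

theorem IsGroebner.exists_lm_le {m : AdmissibleOrder σ} (hG : m.IsGroebner G)
    {p : MvPolynomial σ K} (hp : p ∈ Ideal.span G) (hp0 : p ≠ 0) :
    ∃ g ∈ G, g ≠ 0 ∧ m.lm g ≤ m.lm p := by
  by_contra! hs
  simpa using (m.greatest_support_of_reflTransGen hs (hG.reflTransGen_zero hp)
    (m.lm_spec hp0)).1

theorem join_of_sub_mem_span [Finite σ]
    (hG : ∀ p ∈ Ideal.span G, p ≠ 0 → ∃ g ∈ G, g ≠ 0 ∧ m.lm g ≤ m.lm p)
    {p q : MvPolynomial σ K} (h : p - q ∈ Ideal.span G) :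
    Join (ReflTransGen (m.Red G)) p q := by
  induction hs : m.lm (p - q) using m.wellFounded_lt.induction generalizing p q with
  | _ s ih =>
    subst hs
    rcases eq_or_ne (p - q) 0 with h0 | h0
    · rw [sub_eq_zero.1 h0]
      exact refl_of _ q
    obtain ⟨g, hgG, hg, hle⟩ := hG _ h h0
    obtain ⟨t, ht⟩ : ∃ t, t + m.lm g = m.lm (p - q) := ⟨_, tsub_add_cancel_of_le hle⟩
    suffices Join (ReflTransGen (m.Red G)) (m.reduceAt g t p) (m.reduceAt g t q) by
      obtain ⟨d, hpd, hqd⟩ := this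
      exact ⟨d, (m.reflTransGen_reduceAt hgG hg t p).trans hpd,
        (m.reflTransGen_reduceAt hgG hg t q).trans hqd⟩
    rcases eq_or_ne (m.reduceAt g t (p - q)) 0 with h1 | h1
    · rw [reduceAt_sub, sub_eq_zero] at h1
      rw [h1]
      exact refl_of _ _
    · have hlm := (m.lm_spec h1).1
      refine ih (m.lm (m.reduceAt g t (p - q))) ⟨?_, fun heq => ?_⟩ ?_ (by rw [reduceAt_sub])
      · exact m.le_of_mem_support_reduceAt hg (m.lm_spec h0).2 (ht ▸ m.refl _) _ hlm
      · rw [heq, ← ht, mem_support_iff, m.coeff_reduceAt hg] at hlm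
        exact hlm rfl
      · rw [← reduceAt_sub]
        exact m.reduceAt_mem (Ideal.subset_span hgG) h t

end Reduction

end AdmissibleOrder

/-- A finite set `G` is a Gröbner basis iff the leading monomial of every nonzero element
of the ideal generated by `G` is divisible by the leading monomial of some nonzero
element of `G`. -/
theorem groebner_iff_dvd_leading_monomial {σ K : Type*} [Fintype σ] [Field K]
    (m : AdmissibleOrder σ) (G : Set (MvPolynomial σ K)) (hG : G.Finite) :
    m.IsGroebner G ↔
      ∀ p ∈ Ideal.span G, p ≠ 0 → ∃ g ∈ G, g ≠ 0 ∧ ∀ x, m.lm g x ≤ m.lm p x := by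
  refine ⟨fun h p hp hp0 => h.exists_lm_le hp hp0, fun h a b c hab hac => ?_⟩
  refine m.join_of_sub_mem_span h ?_
  rw [← sub_sub_sub_cancel_left]
  exact sub_mem (m.sub_mem_span_of_reflTransGen hac) (m.sub_mem_span_of_reflTransGen hab)
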